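/- Let m ∈ ℕ, Π ⊆ ℝ[x_1,…,x_m] be a polynomial subspace, P ⊆ ℝ^m a finite non-empty set, and H = Q_H^{-1}(0) a hyperplane of co-dimension 1 defined by a polynomial Q_H ∈ Π_{m,1,1} \ {0}, such that every affine transformation τ_H with τ_H(H) = ℝ^{m−1}×{0} is canonical with respect to Π. If P is unisolvent with respect to the pair (Π, H), then P is unisolvent with respect to Π. -/

import Mathlib

open MvPolynomial
open scoped Classical

noncomputable section

/-- The pullback `τ^*` of a polynomial along the affine transformation
`τ(x) = B x + b`, i.e. `τ^*(Q)(x) = Q(τ(x))`. -/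
def affinePullback {m : ℕ} (B : Matrix (Fin m) (Fin m) ℝ) (b : Fin m → ℝ) :
    MvPolynomial (Fin m) ℝ →ₐ[ℝ] MvPolynomial (Fin m) ℝ :=
  aeval fun i => (∑ j, C (B i j) * X j) + C (b i)

open Matrix in
theorem eval_affinePullback {m : ℕ} (A : Matrix (Fin m) (Fin m) ℝ) (a x : Fin m → ℝ)
    (Q : MvPolynomial (Fin m) ℝ) :
    eval x (affinePullback A a Q) = eval (A *ᵥ x + a) Q := by
  have h : (aeval x).comp (affinePullback A a) = aeval (A *ᵥ x + a) := by
    ext i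
    simp [affinePullback, mulVec, dotProduct]
  simpa [aeval_eq_eval] using DFunLike.congr_fun h Q

open Matrix in
theorem affinePullback_affinePullback {m : ℕ} (A B : Matrix (Fin m) (Fin m) ℝ)
    (a b : Fin m → ℝ) (Q : MvPolynomial (Fin m) ℝ) :
    affinePullback B b (affinePullback A a Q) = affinePullback (A * B) (A *ᵥ b + a) Q := by
  refine MvPolynomial.funext fun x => ?_
  simp only [eval_affinePullback, mulVec_add, mulVec_mulVec, add_assoc]

theorem affinePullback_one_zero {m : ℕ} (Q : MvPolynomial (Fin m) ℝ) :
    affinePullback 1 0 Q = Q := by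
  refine MvPolynomial.funext fun x => ?_
  simp [eval_affinePullback]

open Matrix in
theorem affinePullback_bijective {m : ℕ} {B : Matrix (Fin m) (Fin m) ℝ} (hB : IsUnit B)
    (b : Fin m → ℝ) : Function.Bijective (affinePullback B b) := by
  have hdet := (isUnit_iff_isUnit_det B).1 hB
  refine Function.bijective_iff_has_inverse.2 ⟨affinePullback B⁻¹ (-(B⁻¹ *ᵥ b)), fun Q => ?_,
    fun Q => ?_⟩
  · rw [affinePullback_affinePullback, mul_nonsing_inv B hdet, mulVec_neg, mulVec_mulVec,
      mul_nonsing_inv B hdet, one_mulVec, neg_add_cancel, affinePullback_one_zero]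
  · rw [affinePullback_affinePullback, nonsing_inv_mul B hdet, add_neg_cancel,
      affinePullback_one_zero]

theorem totalDegree_affinePullback_le {m : ℕ} (A : Matrix (Fin m) (Fin m) ℝ)
    (a : Fin m → ℝ) (Q : MvPolynomial (Fin m) ℝ) :
    (affinePullback A a Q).totalDegree ≤ Q.totalDegree := by
  have hlin (i : Fin m) : ((∑ j, C (A i j) * X j) + C (a i) :
      MvPolynomial (Fin m) ℝ).totalDegree ≤ 1 := by
    refine (totalDegree_add _ _).trans (max_le ?_ (by simp))
    refine totalDegree_finsetSum_le fun j _ => (totalDegree_mul _ _).trans ?_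
    simp
  rw [affinePullback, aeval_def, eval₂_eq']
  refine totalDegree_finsetSum_le fun d hd => (totalDegree_mul _ _).trans ?_
  rw [algebraMap_eq, totalDegree_C, zero_add]
  refine (totalDegree_finsetProd _ _).trans (le_trans ?_ (le_totalDegree hd))
  rw [Finsupp.sum_fintype _ _ fun _ => rfl]
  refine Finset.sum_le_sum fun i _ => (totalDegree_pow _ _).trans ?_
  simpa using Nat.mul_le_mul_left (d i) (hlin i)

/-- An injective affine pullback preserving a subspace also maps onto it, since it preserves the
finite-dimensional subspaces of polynomials of bounded total degree. -/
theorem exists_mem_affinePullback_eq {m : ℕ} {B : Matrix (Fin m) (Fin m) ℝ} (hB : IsUnit B)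
    (b : Fin m → ℝ) {V : Submodule ℝ (MvPolynomial (Fin m) ℝ)}
    (hV : ∀ Q ∈ V, affinePullback B b Q ∈ V) {Q : MvPolynomial (Fin m) ℝ} (hQ : Q ∈ V) :
    ∃ R ∈ V, affinePullback B b R = Q := by
  set W := V ⊓ restrictTotalDegree (Fin m) ℝ Q.totalDegree
  have hmem : ∀ R ∈ W, (affinePullback B b).toLinearMap R ∈ W := fun R hR =>
    ⟨hV R hR.1, (mem_restrictTotalDegree _ _ _).2 ((totalDegree_affinePullback_le B b R).trans
      ((mem_restrictTotalDegree _ _ _).1 hR.2))⟩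
  have : FiniteDimensional ℝ W := Submodule.finiteDimensional_of_le
    (inf_le_right : W ≤ restrictTotalDegree (Fin m) ℝ Q.totalDegree)
  have hinj : Function.Injective ((affinePullback B b).toLinearMap.restrict hmem) :=
    fun x y hxy => Subtype.ext ((affinePullback_bijective hB b).1 (congrArg Subtype.val hxy))
  obtain ⟨R, hR⟩ := LinearMap.injective_iff_surjective.1 hinj
    ⟨Q, hQ, (mem_restrictTotalDegree _ _ _).2 le_rfl⟩
  exact ⟨R, R.2.1, congrArg Subtype.val hR⟩

theorem Submodule.coeff_zero_mem_of_infinite_eval_mem {A : Type*} [CommRing A] [Algebra ℝ A]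
    (V : Submodule ℝ A) (F : Polynomial A)
    (hF : {t : ℝ | F.eval (algebraMap ℝ A t) ∈ V}.Infinite) : F.coeff 0 ∈ V := by
  by_contra hv
  obtain ⟨f, hf, hVf⟩ := Submodule.exists_le_ker_of_notMem hv
  set p : Polynomial ℝ := ∑ k ∈ F.support, Polynomial.monomial k (f (F.coeff k)) with hp
  have heval (t : ℝ) : p.eval t = f (F.eval (algebraMap ℝ A t)) := by
    rw [hp, Polynomial.eval_finsetSum, Polynomial.eval_eq_sum, Polynomial.sum, map_sum]
    refine Finset.sum_congr rfl fun k _ => ?_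
    rw [Polynomial.eval_monomial, ← map_pow, mul_comm (F.coeff k), ← Algebra.smul_def, map_smul,
      smul_eq_mul, mul_comm]
  have hp0 : p = 0 := Polynomial.eq_zero_of_infinite_isRoot p
    (hF.mono fun t ht => (heval t).trans (hVf ht))
  have := heval 0
  rw [hp0, Polynomial.eval_zero, map_zero, ← Polynomial.coeff_zero_eq_eval_zero] at this
  exact hf this.symm

open Matrix in
/-- The affine maps whose pullback preserves a subspace form a Zariski closed set; this is the
closure along a line. -/
theorem affinePullback_mem_of_infinite {m : ℕ} (V : Submodule ℝ (MvPolynomial (Fin m) ℝ))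
    (A B : Matrix (Fin m) (Fin m) ℝ) (a b : Fin m → ℝ) (Q : MvPolynomial (Fin m) ℝ)
    (h : {t : ℝ | affinePullback (A + t • B) (a + t • b) Q ∈ V}.Infinite) :
    affinePullback A a Q ∈ V := by
  set F : Polynomial (MvPolynomial (Fin m) ℝ) := aeval (fun i =>
    Polynomial.C (affinePullback A a (X i)) +
      Polynomial.X * Polynomial.C (affinePullback B b (X i))) Q with hF
  have heval (t : ℝ) : F.eval (C t) = affinePullback (A + t • B) (a + t • b) Q := by
    have hcomp : ((Polynomial.aeval (R := MvPolynomial (Fin m) ℝ)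
        (C t : MvPolynomial (Fin m) ℝ)).restrictScalars ℝ).comp (aeval (fun i =>
        Polynomial.C (affinePullback A a (X i)) +
          Polynomial.X * Polynomial.C (affinePullback B b (X i)))) =
        affinePullback (A + t • B) (a + t • b) := by
      refine MvPolynomial.algHom_ext fun i => ?_
      simp only [AlgHom.comp_apply, affinePullback, aeval_X, AlgHom.restrictScalars_apply,
        map_add, map_mul, Polynomial.aeval_C, Polynomial.aeval_X, Algebra.algebraMap_self,
        RingHom.id_apply, Matrix.add_apply, Matrix.smul_apply, Pi.add_apply, Pi.smul_apply,
        smul_eq_mul, add_mul, Finset.sum_add_distrib, mul_add, Finset.mul_sum, mul_assoc]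
      ring
    exact DFunLike.congr_fun hcomp Q
  have hmem := V.coeff_zero_mem_of_infinite_eval_mem F (by simpa [algebraMap_eq, heval] using h)
  have h0 := heval 0
  rw [C_0, ← Polynomial.coeff_zero_eq_eval_zero, zero_smul, zero_smul, add_zero, add_zero] at h0
  rwa [h0] at hmem

open Matrix in
theorem infinite_setOf_isUnit_add_smul {m : ℕ} (A : Matrix (Fin m) (Fin m) ℝ)
    {B : Matrix (Fin m) (Fin m) ℝ} (hB : IsUnit B) (s : ℝ) :
    {t : ℝ | IsUnit (A + t • B) ∧ s + t ≠ 0}.Infinite := by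
  have hdet := (isUnit_iff_isUnit_det B).1 hB
  set p := (-(A * B⁻¹)).charpoly
  have hp : p ≠ 0 := (charpoly_monic _).ne_zero
  have hfin : ({t | p.IsRoot t} ∪ {-s}).Finite :=
    (Polynomial.finite_setOfPred_isRoot hp).union (Set.finite_singleton _)
  refine hfin.infinite_compl.mono fun t ht => ?_
  simp only [Set.mem_compl_iff, Set.mem_union, Set.mem_ofPred_eq, Set.mem_singleton_iff,
    not_or] at ht
  refine ⟨?_, fun h => ht.2 (by linarith)⟩
  have hfac : A + t • B = (scalar (Fin m) t - -(A * B⁻¹)) * B := by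
    rw [sub_neg_eq_add, add_mul, nonsing_inv_mul_cancel_right _ _ hdet, scalar_apply,
      ← smul_eq_diagonal_mul, add_comm]
  rw [hfac]
  refine IsUnit.mul ?_ hB
  rw [isUnit_iff_isUnit_det, ← eval_charpoly]
  exact isUnit_iff_ne_zero.2 ht.1

theorem affinePullback_support_apply_eq_zero {m : ℕ} {A : Matrix (Fin m) (Fin m) ℝ}
    (a : Fin m → ℝ) {k : Fin m} (hA : ∀ i, A i k = 0) (Q : MvPolynomial (Fin m) ℝ) :
    ∀ d ∈ (affinePullback A a Q).support, d k = 0 := by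
  have hmem : affinePullback A a Q ∈ supported ℝ ({k}ᶜ : Set (Fin m)) := by
    rw [affinePullback, aeval_def]
    have hlin (i : Fin m) : (∑ j, C (A i j) * X j) + C (a i) ∈
        supported ℝ ({k}ᶜ : Set (Fin m)) := by
      refine add_mem (Subalgebra.sum_mem _ fun j _ => ?_) (Subalgebra.algebraMap_mem _ (a i))
      by_cases hj : j = k
      · simp [hj, hA]
      · exact mul_mem (Subalgebra.algebraMap_mem _ (A i j)) (X_mem_supported.2 hj)
    exact eval₂_mem (s := supported ℝ ({k}ᶜ : Set (Fin m)))
      (fun d _ => Subalgebra.algebraMap_mem _ _) hlin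
  intro d hd
  by_contra hdk
  exact mem_supported.1 hmem
    ((mem_vars_iff_mem_support k).2 ⟨d, hd, Finsupp.mem_support_iff.2 hdk⟩) rfl

theorem X_dvd_of_eval_eq_zero {m : ℕ} {k : Fin m} {Q : MvPolynomial (Fin m) ℝ}
    (hQ : ∀ x : Fin m → ℝ, x k = 0 → eval x Q = 0) : X k ∣ Q := by
  set f : MvPolynomial (Fin m) ℝ →ₐ[ℝ] MvPolynomial (Fin m) ℝ :=
    aeval (Function.update X k 0) with hf
  have hfQ : f Q = 0 := by
    refine MvPolynomial.funext fun x => ?_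
    have hcomp : (aeval x).comp f = aeval (Function.update x k 0) := by
      refine MvPolynomial.algHom_ext fun i => ?_
      by_cases hi : i = k
      · subst hi; simp [hf]
      · simp [hf, hi]
    have := DFunLike.congr_fun hcomp Q
    simp only [AlgHom.comp_apply, aeval_eq_eval] at this
    rw [map_zero]
    exact this.trans (hQ _ (by simp))
  rw [← Ideal.mem_span_singleton, ← Ideal.Quotient.eq_zero_iff_mem]
  have hcomp : (Ideal.Quotient.mkₐ ℝ (Ideal.span {X k})).comp f =
      Ideal.Quotient.mkₐ ℝ (Ideal.span {(X k : MvPolynomial (Fin m) ℝ)}) := by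
    refine MvPolynomial.algHom_ext fun i => ?_
    by_cases hi : i = k
    · subst hi
      simp [hf]
    · simp [hf, hi]
  have := DFunLike.congr_fun hcomp Q
  simpa [hfQ] using this.symm

open Matrix in
theorem mulVec_add_bijective {m : ℕ} {B : Matrix (Fin m) (Fin m) ℝ} (hB : IsUnit B)
    (b : Fin m → ℝ) : Function.Bijective fun x => B *ᵥ x + b :=
  (Equiv.addRight b).bijective.comp (⟨mulVec_injective_iff_isUnit.2 hB, mulVec_surjective_iff_isUnit.2 hB⟩)

open Matrix in
theorem mem_iff_of_image_mulVec_add {m : ℕ} {B : Matrix (Fin m) (Fin m) ℝ} (hB : IsUnit B)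
    {b : Fin m → ℝ} {k : Fin m} {H : Set (Fin m → ℝ)}
    (himg : (fun x => B *ᵥ x + b) '' H = {x | x k = 0}) (x : Fin m → ℝ) :
    x ∈ H ↔ (B *ᵥ x + b) k = 0 := by
  rw [← (mulVec_add_bijective hB b).1.mem_set_image, himg]
  rfl

open Matrix in
/-- Canonicity of the affine transformations mapping `H` onto the coordinate hyperplane extends to
the possibly singular affine maps whose `k`-th coordinate is a multiple of an equation of `H`. -/
theorem affinePullback_mem_of_row_eq_smul {m : ℕ} {k : Fin m} {H : Set (Fin m → ℝ)}
    {V : Submodule ℝ (MvPolynomial (Fin m) ℝ)}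
    (hcanon : ∀ (B' : Matrix (Fin m) (Fin m) ℝ) (b' : Fin m → ℝ), IsUnit B' →
      (fun x => B' *ᵥ x + b') '' H = {x | x k = 0} → ∀ Q ∈ V, affinePullback B' b' Q ∈ V)
    {B : Matrix (Fin m) (Fin m) ℝ} {b : Fin m → ℝ} (hB : IsUnit B)
    (himg : (fun x => B *ᵥ x + b) '' H = {x | x k = 0})
    {A : Matrix (Fin m) (Fin m) ℝ} {a : Fin m → ℝ} (s : ℝ)
    (hA : ∀ x, (A *ᵥ x + a) k = s * (B *ᵥ x + b) k)
    {Q : MvPolynomial (Fin m) ℝ} (hQ : Q ∈ V) : affinePullback A a Q ∈ V := by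
  refine affinePullback_mem_of_infinite V A B a b Q
    ((infinite_setOf_isUnit_add_smul A hB s).mono fun t ht => ?_)
  refine hcanon _ _ ht.1 ?_ Q hQ
  have hk (x : Fin m → ℝ) :
      ((A + t • B) *ᵥ x + (a + t • b)) k = (s + t) * (B *ᵥ x + b) k := by
    have := hA x
    simp only [add_mulVec, smul_mulVec, Pi.add_apply, Pi.smul_apply, smul_eq_mul] at this ⊢
    linear_combination this
  have hH : H = (fun x => (A + t • B) *ᵥ x + (a + t • b)) ⁻¹' {x | x k = 0} := by
    ext x
    simp [mem_iff_of_image_mulVec_add hB himg x, hk, ht.2]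
  rw [hH, Set.image_preimage_eq _ (mulVec_add_bijective ht.1 _).2]

open Matrix in
/-- A polynomial vanishing on the preimage of a coordinate hyperplane under an affine
transformation is divisible by the corresponding affine polynomial. -/
theorem affinePullback_X_dvd {m : ℕ} {k : Fin m} {B : Matrix (Fin m) (Fin m) ℝ}
    (hB : IsUnit B) {b : Fin m → ℝ} {Q : MvPolynomial (Fin m) ℝ}
    (hQ : ∀ x, (B *ᵥ x + b) k = 0 → eval x Q = 0) : affinePullback B b (X k) ∣ Q := by
  obtain ⟨R, rfl⟩ := (affinePullback_bijective hB b).2 Q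
  refine map_dvd _ (X_dvd_of_eval_eq_zero fun y hy => ?_)
  obtain ⟨x, rfl⟩ := (mulVec_add_bijective hB b).2 y
  rw [← eval_affinePullback]
  exact hQ x hy

/-- If `P` is unisolvent with respect to the pair `(Π, H)`, where
`H = Q_H⁻¹(0)` is a hyperplane cut out by a degree-one polynomial `Q_H ∈ Π_{m,1,1} \ {0}`
such that every affine transformation mapping `H` onto `ℝ^{m-1} × {0}` is canonical with
respect to `Π`, then `P` is unisolvent with respect to `Π`. -/
theorem unisolvent_of_pair_unisolvent (m : ℕ) (hm : 0 < m)
    (Pspace : Submodule ℝ (MvPolynomial (Fin m) ℝ))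
    (P : Set (Fin m → ℝ)) (hPfin : P.Finite) (hPne : P.Nonempty)
    (QH : MvPolynomial (Fin m) ℝ)
    -- `Q_H ∈ Π_{m,1,1} \ {0}` cutting out a hyperplane of co-dimension 1
    (hQHdeg : QH.totalDegree = 1)
    (H : Set (Fin m → ℝ)) (hH : H = {x | eval x QH = 0})
    -- every affine transformation mapping `H` onto `ℝ^{m-1} × {0}` is canonical w.r.t. `Π`
    (hcanon : ∀ (B' : Matrix (Fin m) (Fin m) ℝ) (b' : Fin m → ℝ), IsUnit B' →
      (fun x => B'.mulVec x + b') '' H = {x | x ⟨m - 1, Nat.sub_lt hm Nat.one_pos⟩ = 0} →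
      ∀ Q ∈ Pspace, affinePullback B' b' Q ∈ Pspace)
    -- a fixed affine transformation `τ_H` with `τ_H(H) = ℝ^{m-1} × {0}`
    (B : Matrix (Fin m) (Fin m) ℝ) (b : Fin m → ℝ) (hB : IsUnit B)
    (himg : (fun x => B.mulVec x + b) '' H
      = {x | x ⟨m - 1, Nat.sub_lt hm Nat.one_pos⟩ = 0})
    -- (i): there is no `Q ∈ Π_{|H}` with `τ_H^* Q ≠ 0` vanishing on `P ∩ H`
    (hi : ¬ ∃ Q : MvPolynomial (Fin m) ℝ,
      (Q ∈ Pspace ∧ affinePullback B b Q ∈ Pspace ∧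
        ∀ d ∈ (affinePullback B b Q).support, d ⟨m - 1, Nat.sub_lt hm Nat.one_pos⟩ = 0) ∧
      affinePullback B b Q ≠ 0 ∧ ∀ x ∈ P ∩ H, eval x Q = 0)
    -- (ii): there is no nonzero `Q ∈ Π_{|H̄}` vanishing on `P \ H`
    (hii : ¬ ∃ Q : MvPolynomial (Fin m) ℝ,
      QH * Q ∈ Pspace ∧ Q ≠ 0 ∧ ∀ x ∈ P \ H, eval x Q = 0) :
    -- conclusion: `P` is unisolvent with respect to `Π`
    ∀ Q ∈ Pspace, (∀ x ∈ P, eval x Q = 0) → Q = 0 := by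
  set k : Fin m := ⟨m - 1, Nat.sub_lt hm Nat.one_pos⟩
  intro Q hQ hQP
  have hHiff := mem_iff_of_image_mulVec_add hB himg
  have hrow {A : Matrix (Fin m) (Fin m) ℝ} {a : Fin m → ℝ} (s : ℝ)
      (hA : ∀ x, (A.mulVec x + a) k = s * (B.mulVec x + b) k) :
      ∀ R ∈ Pspace, affinePullback A a R ∈ Pspace := fun R hR =>
    affinePullback_mem_of_row_eq_smul hcanon hB himg s hA hR
  have hτ := hcanon B b hB himg
  -- a polynomial of `Π` constant in the direction `B e_k` and vanishing on `P ∩ H` is zero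
  have hzero {A : Matrix (Fin m) (Fin m) ℝ} {a : Fin m → ℝ} {R : MvPolynomial (Fin m) ℝ}
      {c : ℝ} (hR : affinePullback A a R - C c ∈ Pspace) (hA : ∀ i, (A * B) i k = 0)
      (hvan : ∀ x ∈ P ∩ H, eval x (affinePullback A a R - C c) = 0) :
      affinePullback A a R - C c = 0 := by
    by_contra hne
    refine hi ⟨_, ⟨hR, hτ _ hR, ?_⟩,
      (map_ne_zero_iff _ (affinePullback_bijective hB b).1).2 hne, hvan⟩
    have hC : affinePullback (A * B) (A.mulVec b + a) (R - C c) =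
        affinePullback B b (affinePullback A a R - C c) := by
      rw [← affinePullback_affinePullback, map_sub (affinePullback A a)]
      simp [affinePullback]
    rw [← hC]
    exact affinePullback_support_apply_eq_zero _ hA _
  by_cases hw : (B * B) k k = 0
  · -- `B e_k` is parallel to `H`
    have hconst : ∀ p, eval p Q = eval 0 Q := by
      intro p
      set A := Matrix.vecMulVec p (B k) with hAdef
      have hAx (x : Fin m → ℝ) : A.mulVec x + b k • p = ((B.mulVec x + b) k) • p := by
        rw [hAdef, Matrix.vecMulVec_mulVec, Pi.add_apply, add_smul]
        ext i
        simp [Matrix.mulVec]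
      have h0 : affinePullback (0 : Matrix (Fin m) (Fin m) ℝ) 0 Q = C (eval 0 Q) := by
        refine MvPolynomial.funext fun x => ?_
        simp [eval_affinePullback]
      have hmem : affinePullback A (b k • p) Q - C (eval 0 Q) ∈ Pspace := by
        refine sub_mem (hrow (p k) (fun x => ?_) Q hQ) (h0 ▸ hrow 0 (fun x => ?_) Q hQ)
        · rw [hAx, Pi.smul_apply, smul_eq_mul, mul_comm]
        · simp
      have hz := hzero hmem (fun i => ?_) fun x hx => ?_
      · obtain ⟨x, hx⟩ := (mulVec_add_bijective hB b).2 (Pi.single k 1)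
        have := congrArg (eval x) hz
        rw [map_sub, eval_affinePullback, hAx, show B.mulVec x + b = _ from hx] at this
        simpa [sub_eq_zero] using this
      · rw [hAdef, Matrix.mul_apply]
        simp only [Matrix.vecMulVec_apply, mul_assoc, ← Finset.mul_sum]
        rw [← Matrix.mul_apply, hw, mul_zero]
      · rw [map_sub, eval_affinePullback, hAx, (hHiff x).1 hx.2]
        simp
    obtain ⟨x₀, hx₀⟩ := hPne
    refine MvPolynomial.funext fun p => ?_
    rw [hconst p, ← hconst x₀, hQP x₀ hx₀, map_zero]
  · -- `B e_k` is transverse to `H`: compare `Q` with its composite with the projection onto `H`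
    obtain ⟨R, hR, rfl⟩ := exists_mem_affinePullback_eq hB b hτ hQ
    set w := (B * B) k k with hwdef
    set u : Fin m → ℝ := fun i => w⁻¹ * (B * B) i k with hu
    have huk : u k = 1 := inv_mul_cancel₀ hw
    set A := B - Matrix.vecMulVec u (B k) with hAdef
    have hAx (x : Fin m → ℝ) : A.mulVec x + (b - b k • u) =
        (B.mulVec x + b) - ((B.mulVec x + b) k) • u := by
      rw [hAdef, Matrix.sub_mulVec, Matrix.vecMulVec_mulVec, Pi.add_apply, add_smul]
      ext i
      simp [Matrix.mulVec]
      ring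
    have hH0 : ∀ x ∈ H,
        eval x (affinePullback A (b - b k • u) R) = eval x (affinePullback B b R) := by
      intro x hx
      rw [eval_affinePullback, hAx, (hHiff x).1 hx, zero_smul, sub_zero, eval_affinePullback]
    have hz : affinePullback A (b - b k • u) R - C 0 = 0 := by
      refine hzero ?_ (fun i => ?_) fun x hx => ?_
      · rw [C_0, sub_zero]
        refine hrow 0 (fun x => ?_) R hR
        rw [hAx]
        simp [huk]
      · rw [hAdef, sub_mul, Matrix.sub_apply, Matrix.mul_apply (M := Matrix.vecMulVec u (B k))]
        simp only [Matrix.vecMulVec_apply, mul_assoc, ← Finset.mul_sum]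
        rw [← Matrix.mul_apply, ← hwdef, hu]
        field_simp
        ring
      · rw [C_0, sub_zero, hH0 x hx.2, hQP x hx.1]
    rw [C_0, sub_zero] at hz
    obtain ⟨Q₁, hQ₁⟩ : affinePullback B b (X k) ∣ affinePullback B b R :=
      affinePullback_X_dvd hB fun x hx => by
        rw [← hH0 x ((hHiff x).2 hx), hz, map_zero]
    obtain ⟨g, hg⟩ : affinePullback B b (X k) ∣ QH :=
      affinePullback_X_dvd hB fun x hx => by
        have := (hHiff x).2 hx
        rwa [hH] at this
    have hQH0 : QH ≠ 0 := by
      rintro rfl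
      simp at hQHdeg
    have hg0 : g ≠ 0 := by
      rintro rfl
      exact hQH0 (by rw [hg, mul_zero])
    have hl0 : affinePullback B b (X k) ≠ 0 :=
      (map_ne_zero_iff _ (affinePullback_bijective hB b).1).2 (X_ne_zero k)
    have hldeg : (affinePullback B b (X k)).totalDegree ≠ 0 := by
      intro h
      rw [totalDegree_eq_zero_iff_eq_C] at h
      have h' : affinePullback B b (X k) = affinePullback B b
          (C (coeff 0 (affinePullback B b (X k)))) := by
        rw [h]
        simp [affinePullback]
      have := congrArg totalDegree ((affinePullback_bijective hB b).1 h')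
      rw [totalDegree_X, totalDegree_C] at this
      exact one_ne_zero this
    have hgdeg : g.totalDegree = 0 := by
      have := totalDegree_mul_of_isDomain hl0 hg0
      rw [← hg, hQHdeg] at this
      omega
    rw [totalDegree_eq_zero_iff_eq_C] at hgdeg
    set c := coeff 0 g
    have hc : c ≠ 0 := by
      rintro hc
      rw [hc, C_0] at hgdeg
      exact hg0 hgdeg
    by_contra hne
    refine hii ⟨C c⁻¹ * Q₁, ?_, ?_, fun x hx => ?_⟩
    · have : QH * (C c⁻¹ * Q₁) = affinePullback B b R := by
        rw [hg, hgdeg, hQ₁, mul_assoc, ← mul_assoc (C c), ← C_mul, mul_inv_cancel₀ hc, C_1,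
          one_mul]
      rwa [this]
    · refine mul_ne_zero (C_ne_zero.2 (inv_ne_zero hc)) ?_
      rintro rfl
      exact hne (by rw [hQ₁, mul_zero])
    · have hev := hQP x hx.1
      rw [hQ₁, map_mul, mul_eq_zero, eval_affinePullback, eval_X] at hev
      rw [map_mul, hev.resolve_left fun h => hx.2 ((hHiff x).2 h), mul_zero]

end
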